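/- Consider a feedforward neural network of depth D ≥ 2 with widths n_0 = d, n_1, …, n_{D−1} ∈ ℕ⁺, n_D = 1 and activation ρ : ℝ → ℝ satisfying |ρ(t)| ≤ 1 for all t and |ρ(s) − ρ(t)| ≤ |s − t| for all s, t. Let B_θ ≥ 1 and let θ, θ̃ be two parameter vectors whose weights are all bounded by B_θ. Then for every x ∈ ℝ^d with |x_j| ≤ 1 for all j, |f(x; θ) − f(x; θ̃)| ≤ √W · B_θ^{D−1} · (∏_{i=1}^{D−1} n_i) · ‖θ − θ̃‖₂. -/

import Mathlib

/-- Parameters of a feedforward neural network with widths `n 0, n 1, n 2, …`: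
`A ℓ` is the `n (ℓ+1) × n ℓ` weight matrix and `b ℓ` the bias vector of layer `ℓ+1`. -/
structure NNParams (n : ℕ → ℕ) where
  A : (ℓ : ℕ) → Fin (n (ℓ + 1)) → Fin (n ℓ) → ℝ
  b : (ℓ : ℕ) → Fin (n (ℓ + 1)) → ℝ

/-- Hidden-layer outputs: `f⁰(x) = x`, `f^{ℓ+1}(x) = ρ(A_{ℓ+1} f^ℓ(x) + b_{ℓ+1})` entrywise. -/
noncomputable def nnHidden {n : ℕ → ℕ} (ρ : ℝ → ℝ) (θ : NNParams n) :
    (ℓ : ℕ) → ((Fin (n 0) → ℝ) → Fin (n ℓ) → ℝ)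
  | 0 => fun x => x
  | ℓ + 1 => fun x q => ρ ((∑ j, θ.A ℓ q j * nnHidden ρ θ ℓ x j) + θ.b ℓ q)

/-- Network output of depth `D`: the last layer is affine (no activation),
`f(x;θ) = A_D f^{D−1}(x;θ) + b_D`. -/
noncomputable def nnOut {n : ℕ → ℕ} (ρ : ℝ → ℝ) (θ : NNParams n) :
    (D : ℕ) → ((Fin (n 0) → ℝ) → Fin (n D) → ℝ)
  | 0 => fun x => x
  | D + 1 => fun x q => (∑ j, θ.A D q j * nnHidden ρ θ D x j) + θ.b D q

/-- `W`: the total number of scalar parameters of a depth-`D` network. -/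
def nnW (n : ℕ → ℕ) (D : ℕ) : ℕ :=
  ∑ ℓ ∈ Finset.range D, (n (ℓ + 1) * n ℓ + n (ℓ + 1))

/-- Squared Euclidean distance between the parameter vectors of two depth-`D` networks. -/
noncomputable def paramSq {n : ℕ → ℕ} (θ θ' : NNParams n) (D : ℕ) : ℝ :=
  ∑ ℓ ∈ Finset.range D,
    ((∑ q, ∑ j, (θ.A ℓ q j - θ'.A ℓ q j) ^ 2) + ∑ q, (θ.b ℓ q - θ'.b ℓ q) ^ 2)

/-- Euclidean distance `‖θ − θ̃‖₂` between the parameter vectors of two depth-`D` networks. -/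
noncomputable def paramDist {n : ℕ → ℕ} (θ θ' : NNParams n) (D : ℕ) : ℝ :=
  Real.sqrt (paramSq θ θ' D)

/-- All weights of the depth-`D` network `θ` are bounded in absolute value by `Bθ`. -/
def weightsBounded {n : ℕ → ℕ} (θ : NNParams n) (D : ℕ) (Bθ : ℝ) : Prop :=
  ∀ ℓ < D, (∀ q j, |θ.A ℓ q j| ≤ Bθ) ∧ (∀ q, |θ.b ℓ q| ≤ Bθ)

/-- The `ℓ¹` distance between the parameters of layer `ℓ + 1` of two networks. -/
noncomputable def layerDist {n : ℕ → ℕ} (θ θ' : NNParams n) (ℓ : ℕ) : ℝ :=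
  ∑ q, ((∑ j, |θ.A ℓ q j - θ'.A ℓ q j|) + |θ.b ℓ q - θ'.b ℓ q|)

theorem layerDist_nonneg {n : ℕ → ℕ} (θ θ' : NNParams n) (ℓ : ℕ) : 0 ≤ layerDist θ θ' ℓ := by
  unfold layerDist
  positivity

theorem layerDist_le_sqrt_mul_sqrt {n : ℕ → ℕ} (θ θ' : NNParams n) (ℓ : ℕ) :
    layerDist θ θ' ℓ ≤ √((n (ℓ + 1) * n ℓ + n (ℓ + 1) : ℕ) : ℝ) *
      √((∑ q, ∑ j, (θ.A ℓ q j - θ'.A ℓ q j) ^ 2) + ∑ q, (θ.b ℓ q - θ'.b ℓ q) ^ 2) := by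
  rw [← Real.sqrt_mul (Nat.cast_nonneg _)]
  apply Real.le_sqrt_of_sq_le
  have h := sq_sum_le_card_mul_sum_sq
    (s := (Finset.univ : Finset ((Fin (n (ℓ + 1)) × Fin (n ℓ)) ⊕ Fin (n (ℓ + 1)))))
    (f := Sum.elim (fun p => |θ.A ℓ p.1 p.2 - θ'.A ℓ p.1 p.2|)
      (fun q => |θ.b ℓ q - θ'.b ℓ q|))
  simpa [Fintype.sum_sum_type, Fintype.sum_prod_type, layerDist, Finset.sum_add_distrib,
    sq_abs] using h

theorem sum_layerDist_le {n : ℕ → ℕ} (θ θ' : NNParams n) (D : ℕ) :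
    ∑ ℓ ∈ Finset.range D, layerDist θ θ' ℓ ≤ √(nnW n D) * paramDist θ θ' D := by
  refine (Finset.sum_le_sum fun ℓ _ => layerDist_le_sqrt_mul_sqrt θ θ' ℓ).trans ?_
  rw [paramDist, paramSq, nnW, Nat.cast_sum]
  exact Real.sum_sqrt_mul_sqrt_le _ (fun _ => Nat.cast_nonneg _) (fun _ => by positivity)

theorem abs_nnHidden_le_one {n : ℕ → ℕ} {ρ : ℝ → ℝ} (hρb : ∀ t, |ρ t| ≤ 1) (θ : NNParams n)
    {x : Fin (n 0) → ℝ} (hx : ∀ j, |x j| ≤ 1) (ℓ : ℕ) (q : Fin (n ℓ)) :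
    |nnHidden ρ θ ℓ x q| ≤ 1 := by
  cases ℓ with
  | zero => exact hx q
  | succ ℓ => exact hρb _

/-- Perturbation bound for an affine form whose weights and arguments both change. -/
theorem abs_affine_sub_le {ι : Type*} [Fintype ι] {B : ℝ} (a a' h h' : ι → ℝ) (b b' : ℝ)
    (ha' : ∀ j, |a' j| ≤ B) (hh : ∀ j, |h j| ≤ 1) :
    |((∑ j, a j * h j) + b) - ((∑ j, a' j * h' j) + b')| ≤
      ((∑ j, |a j - a' j|) + |b - b'|) + B * ∑ j, |h j - h' j| := by
  have key : ((∑ j, a j * h j) + b) - ((∑ j, a' j * h' j) + b') =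
      (∑ j, ((a j - a' j) * h j + a' j * (h j - h' j))) + (b - b') := by
    rw [add_sub_add_comm, ← Finset.sum_sub_distrib]
    congr 1
    exact Finset.sum_congr rfl fun j _ => by ring
  have hsum : |∑ j, ((a j - a' j) * h j + a' j * (h j - h' j))| ≤
      ∑ j, (|a j - a' j| + B * |h j - h' j|) := by
    refine (Finset.abs_sum_le_sum_abs _ _).trans (Finset.sum_le_sum fun j _ => ?_)
    refine (abs_add_le _ _).trans ?_
    rw [abs_mul, abs_mul]
    exact add_le_add (mul_le_of_le_one_right (abs_nonneg _) (hh j))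
      (mul_le_mul_of_nonneg_right (ha' j) (abs_nonneg _))
  rw [key]
  rw [Finset.sum_add_distrib (f := fun j => |a j - a' j|), ← Finset.mul_sum] at hsum
  linarith [abs_add_le (∑ j, ((a j - a' j) * h j + a' j * (h j - h' j))) (b - b')]

theorem one_le_pow_mul_prod {n : ℕ → ℕ} {B : ℝ} (hB : 1 ≤ B) {ℓ : ℕ}
    (hpos : ∀ i ≤ ℓ, 0 < n i) : 1 ≤ B ^ ℓ * ∏ i ∈ Finset.Icc 1 ℓ, (n i : ℝ) := by
  refine one_le_mul_of_one_le_of_one_le (one_le_pow₀ hB) ?_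
  have h : 1 ≤ ∏ i ∈ Finset.Icc 1 ℓ, n i :=
    Finset.prod_pos fun i hi => hpos i (Finset.mem_Icc.mp hi).2
  exact_mod_cast h

theorem mul_sum_abs_nnHidden_sub_le {n : ℕ → ℕ} {D : ℕ} (hpos : ∀ i ≤ D, 0 < n i)
    {ρ : ℝ → ℝ} (hρb : ∀ t, |ρ t| ≤ 1) (hρlip : ∀ s t, |ρ s - ρ t| ≤ |s - t|)
    {B : ℝ} (hB : 1 ≤ B) (θ θ' : NNParams n) (hθ' : weightsBounded θ' D B)
    {x : Fin (n 0) → ℝ} (hx : ∀ j, |x j| ≤ 1) (ℓ : ℕ) (hℓ : ℓ ≤ D) :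
    B * ∑ q, |nnHidden ρ θ ℓ x q - nnHidden ρ θ' ℓ x q| ≤
      (B ^ ℓ * ∏ i ∈ Finset.Icc 1 ℓ, (n i : ℝ)) * ∑ k ∈ Finset.range ℓ, layerDist θ θ' k := by
  induction ℓ with
  | zero => simp [nnHidden]
  | succ ℓ ih =>
    have hB0 : 0 ≤ B := zero_le_one.trans hB
    have hP := one_le_pow_mul_prod hB fun i (hi : i ≤ ℓ) => hpos i (by omega)
    have hn : (1 : ℝ) ≤ n (ℓ + 1) := by exact_mod_cast hpos (ℓ + 1) hℓ
    have hL := layerDist_nonneg θ θ' ℓ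
    specialize ih (by omega)
    rw [Finset.prod_Icc_succ_top (by omega), Finset.sum_range_succ, pow_succ]
    set P := ∏ i ∈ Finset.Icc 1 ℓ, (n i : ℝ)
    set S := ∑ q, |nnHidden ρ θ ℓ x q - nnHidden ρ θ' ℓ x q|
    set L := ∑ k ∈ Finset.range ℓ, layerDist θ θ' k
    have hstep : ∑ q, |nnHidden ρ θ (ℓ + 1) x q - nnHidden ρ θ' (ℓ + 1) x q| ≤
        layerDist θ θ' ℓ + n (ℓ + 1) * (B * S) := by
      have h := Finset.sum_le_sum fun q (_ : q ∈ Finset.univ) =>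
        (hρlip _ _).trans (abs_affine_sub_le (θ.A ℓ q) (θ'.A ℓ q) (nnHidden ρ θ ℓ x)
          (nnHidden ρ θ' ℓ x) (θ.b ℓ q) (θ'.b ℓ q) ((hθ' ℓ hℓ).1 q)
          (abs_nnHidden_le_one hρb θ hx ℓ))
      rw [Finset.sum_add_distrib (g := fun _ => B * _)] at h
      simp only [Finset.sum_const, Finset.card_univ, Fintype.card_fin, nsmul_eq_mul] at h
      exact h
    calc B * ∑ q, |nnHidden ρ θ (ℓ + 1) x q - nnHidden ρ θ' (ℓ + 1) x q|
        ≤ B * (layerDist θ θ' ℓ + n (ℓ + 1) * (B * S)) := by gcongr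
      _ ≤ B * (((B ^ ℓ * P) * n (ℓ + 1)) * layerDist θ θ' ℓ +
            n (ℓ + 1) * ((B ^ ℓ * P) * L)) := by
          gcongr
          exact le_mul_of_one_le_left hL (one_le_mul_of_one_le_of_one_le hP hn)
      _ = B ^ ℓ * B * (P * n (ℓ + 1)) * (L + layerDist θ θ' ℓ) := by ring

/-- **Lemma 5.9: Lipschitz continuity of the network in its parameters.**
For a depth `D ≥ 2` network with widths `n 0 = d ≥ 1`, …, `n D = 1`, activation `ρ` bounded
by `1` and `1`-Lipschitz, and parameter vectors `θ, θ̃` with all weights bounded by `Bθ ≥ 1`,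
for every input `x` with `|x j| ≤ 1` one has
`|f(x;θ) − f(x;θ̃)| ≤ √W · Bθ^{D−1} · (∏_{i=1}^{D−1} n i) · ‖θ − θ̃‖₂`. -/
theorem nn_param_lipschitz (D : ℕ) (hD : 2 ≤ D) (n : ℕ → ℕ)
    (hd : 1 ≤ n 0) (hnD : n D = 1) (hpos : ∀ i ≤ D, 0 < n i)
    (ρ : ℝ → ℝ) (hρb : ∀ t, |ρ t| ≤ 1) (hρlip : ∀ s t, |ρ s - ρ t| ≤ |s - t|)
    (Bθ : ℝ) (hBθ : 1 ≤ Bθ) (θ θ' : NNParams n)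
    (hθ : weightsBounded θ D Bθ) (hθ' : weightsBounded θ' D Bθ)
    (x : Fin (n 0) → ℝ) (hx : ∀ j, |x j| ≤ 1) :
    ∀ q : Fin (n D),
      |nnOut ρ θ D x q - nnOut ρ θ' D x q| ≤
        Real.sqrt (nnW n D) * Bθ ^ (D - 1) * (∏ i ∈ Finset.Icc 1 (D - 1), (n i : ℝ)) *
          paramDist θ θ' D := by
  intro q
  obtain ⟨m, rfl⟩ : ∃ m, D = m + 1 := ⟨D - 1, by omega⟩
  have hS := mul_sum_abs_nnHidden_sub_le hpos hρb hρlip hBθ θ θ' hθ' hx m m.le_succ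
  have hP := one_le_pow_mul_prod hBθ fun i (hi : i ≤ m) => hpos i (by omega)
  have hout := abs_affine_sub_le (θ.A m q) (θ'.A m q) (nnHidden ρ θ m x)
    (nnHidden ρ θ' m x) (θ.b m q) (θ'.b m q) ((hθ' m m.lt_succ_self).1 q)
    (abs_nnHidden_le_one hρb θ hx m)
  have hq : (∑ j, |θ.A m q j - θ'.A m q j|) + |θ.b m q - θ'.b m q| ≤ layerDist θ θ' m :=
    Finset.single_le_sum
      (f := fun q => (∑ j, |θ.A m q j - θ'.A m q j|) + |θ.b m q - θ'.b m q|)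
      (fun _ _ => by positivity) (Finset.mem_univ q)
  have hL := le_mul_of_one_le_left (layerDist_nonneg θ θ' m) hP
  have hsum := mul_le_mul_of_nonneg_left (sum_layerDist_le θ θ' (m + 1))
    (zero_le_one.trans hP)
  rw [Finset.sum_range_succ] at hsum
  simp only [nnOut, Nat.add_sub_cancel]
  linarith
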